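/- Fix M ≥ 1 and let X and Y be independent real random variables each having the chi-square distribution with 2M degrees of freedom (i.e. the Gamma distribution with shape M and rate 1/2), and define ε(α) = P(X ≥ (1 + α)·Y) for α ≥ 0. Then for every ε₀ with 0 < ε₀ < 1/2 there exists a unique α₀ > 0 such that ε(α₀) = ε₀. -/

import Mathlib

open MeasureTheory ProbabilityTheory

open Filter Topology Set

theorem continuous_cdf_of_nullSingletonClass (μ : Measure ℝ) [IsProbabilityMeasure μ]
    [NullSingletonClass μ] :
    Continuous (cdf μ) := by
  refine continuous_iff_continuousAt.2 fun x ↦ ?_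
  rw [(monotone_cdf μ).continuousAt_iff_leftLim_eq_rightLim, StieltjesFunction.rightLim_eq]
  have h : (cdf μ).measure {x} = 0 := by rw [measure_cdf, measure_singleton]
  rw [StieltjesFunction.measure_singleton, ENNReal.ofReal_eq_zero, sub_nonpos] at h
  exact le_antisymm ((monotone_cdf μ).leftLim_le le_rfl) h

theorem measureReal_Ici_eq_one_sub_cdf (μ : Measure ℝ) [IsProbabilityMeasure μ]
    [NullSingletonClass μ] (t : ℝ) : μ.real (Ici t) = 1 - cdf μ t := by
  rw [cdf_eq_real, ← probReal_compl_eq_one_sub measurableSet_Iic, compl_Iic,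
    measureReal_congr Ioi_ae_eq_Ici]

/-- `P(X ≥ cY)` for independent `X, Y` with law `μ`, by conditioning on `Y`. -/
theorem measureReal_prod_mul_snd_le_fst (μ : Measure ℝ) [IsProbabilityMeasure μ]
    [NullSingletonClass μ] (c : ℝ) :
    (μ.prod μ).real {p | c * p.2 ≤ p.1} = ∫ y, (1 - cdf μ (c * y)) ∂μ := by
  have hS : MeasurableSet {p : ℝ × ℝ | c * p.2 ≤ p.1} :=
    measurableSet_le (by fun_prop) (by fun_prop)
  rw [measureReal_def, Measure.prod_apply_symm hS, ← integral_toReal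
    (measurable_measure_prodMk_right hS).aemeasurable
    (Eventually.of_forall fun _ ↦ measure_lt_top _ _)]
  refine integral_congr_ae (Eventually.of_forall fun y ↦ ?_)
  exact measureReal_Ici_eq_one_sub_cdf μ (c * y)

theorem measureReal_prod_snd_le_fst (μ : Measure ℝ) [IsProbabilityMeasure μ]
    [NullSingletonClass μ] :
    (μ.prod μ).real {p | p.2 ≤ p.1} = 1 / 2 := by
  have hS : MeasurableSet {p : ℝ × ℝ | p.2 ≤ p.1} :=
    measurableSet_le measurable_snd measurable_fst
  have h : (μ.prod μ).real {p | p.2 ≤ p.1}ᶜ = (μ.prod μ).real {p | p.2 ≤ p.1} := by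
    rw [measureReal_def, measureReal_def, Measure.prod_apply hS.compl, Measure.prod_apply_symm hS]
    congr 1
    refine lintegral_congr fun x ↦ ?_
    have h1 : Prod.mk x ⁻¹' {p : ℝ × ℝ | p.2 ≤ p.1}ᶜ = Ioi x := by ext; simp
    have h2 : (fun y ↦ (y, x)) ⁻¹' {p : ℝ × ℝ | p.2 ≤ p.1} = Ici x := by ext; simp
    rw [h1, h2, measure_congr Ioi_ae_eq_Ici]
  rw [probReal_compl_eq_one_sub hS] at h
  linarith

section Tail

variable (μ : Measure ℝ)

theorem norm_one_sub_cdf_le_one (x : ℝ) : ‖1 - cdf μ x‖ ≤ 1 := by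
  rw [Real.norm_eq_abs, abs_le]
  constructor <;> linarith [cdf_nonneg μ x, cdf_le_one μ x]

variable [IsProbabilityMeasure μ]

theorem integrable_one_sub_cdf_mul (c : ℝ) : Integrable (fun y ↦ 1 - cdf μ (c * y)) μ := by
  have hm : Measurable (cdf μ) := (monotone_cdf μ).measurable
  exact .of_bound
    (measurable_const.sub (hm.comp (measurable_const_mul c))).aestronglyMeasurable 1
    (Eventually.of_forall fun _ ↦ norm_one_sub_cdf_le_one μ _)

theorem continuous_integral_one_sub_cdf_mul [NullSingletonClass μ] :
    Continuous fun c : ℝ ↦ ∫ y, (1 - cdf μ (c * y)) ∂μ := by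
  have hc := continuous_cdf_of_nullSingletonClass μ
  refine continuous_of_dominated (bound := fun _ ↦ 1) (fun c ↦ by fun_prop)
    (fun c ↦ Eventually.of_forall fun y ↦ norm_one_sub_cdf_le_one μ _) (integrable_const _)
    (Eventually.of_forall fun y ↦ by fun_prop)

theorem tendsto_integral_one_sub_cdf_mul_atTop (hpos : ∀ᵐ y ∂μ, 0 < y) :
    Tendsto (fun c : ℝ ↦ ∫ y, (1 - cdf μ (c * y)) ∂μ) atTop (𝓝 0) := by
  have h : Tendsto (fun c : ℝ ↦ ∫ y, (1 - cdf μ (c * y)) ∂μ) atTop (𝓝 (∫ _, (0 : ℝ) ∂μ)) := by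
    refine tendsto_integral_filter_of_dominated_convergence (fun _ ↦ 1)
      (Eventually.of_forall fun c ↦ (integrable_one_sub_cdf_mul μ c).aestronglyMeasurable)
      (Eventually.of_forall fun c ↦ Eventually.of_forall fun y ↦ norm_one_sub_cdf_le_one μ _)
      (integrable_const _) ?_
    filter_upwards [hpos] with y hy
    simpa using ((tendsto_cdf_atTop μ).comp (tendsto_id.atTop_mul_const hy)).const_sub 1
  simpa using h

theorem strictAntiOn_integral_one_sub_cdf_mul (hpos : ∀ᵐ y ∂μ, 0 < y)
    (hcdf : StrictMonoOn (cdf μ) (Ioi 0)) :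
    StrictAntiOn (fun c : ℝ ↦ ∫ y, (1 - cdf μ (c * y)) ∂μ) (Ioi 0) := by
  intro a ha b hb hab
  have h0 : 0 < ∫ y, ((1 - cdf μ (a * y)) - (1 - cdf μ (b * y))) ∂μ := by
    have hlt : ∀ᵐ y ∂μ, 0 < (1 - cdf μ (a * y)) - (1 - cdf μ (b * y)) := by
      filter_upwards [hpos] with y hy
      have := hcdf (mul_pos ha hy) (mul_pos hb hy) (mul_lt_mul_of_pos_right hab hy)
      linarith
    rw [integral_pos_iff_support_of_nonneg_ae (hlt.mono fun _ h ↦ h.le)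
      ((integrable_one_sub_cdf_mul μ a).sub (integrable_one_sub_cdf_mul μ b))]
    have hs : (Function.support fun y ↦ (1 - cdf μ (a * y)) - (1 - cdf μ (b * y)))
        =ᵐ[μ] (univ : Set ℝ) :=
      eventuallyEq_univ.2 (hlt.mono fun _ h ↦ h.ne')
    rw [measure_congr hs, measure_univ]
    exact one_pos
  rw [integral_sub (integrable_one_sub_cdf_mul μ a) (integrable_one_sub_cdf_mul μ b)] at h0
  exact sub_pos.1 h0

end Tail

instance nullSingletonClass_gammaMeasure (a r : ℝ) : NullSingletonClass (gammaMeasure a r) := by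
  unfold gammaMeasure; infer_instance

theorem ae_pos_gammaMeasure (a r : ℝ) : ∀ᵐ y ∂gammaMeasure a r, 0 < y := by
  have h : gammaMeasure a r (Iic 0) = 0 := by
    rw [← measure_congr (Iio_ae_eq_Iic (μ := gammaMeasure a r)), gammaMeasure,
      withDensity_apply _ measurableSet_Iio]
    exact lintegral_gammaPDF_of_nonpos le_rfl
  rw [ae_iff]
  simpa [Iic] using h

theorem gammaMeasure_Ioc_pos {a r : ℝ} (ha : 0 < a) (hr : 0 < r) {s t : ℝ} (hs : 0 < s)
    (hst : s < t) : 0 < gammaMeasure a r (Ioc s t) := by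
  rw [gammaMeasure, withDensity_apply _ measurableSet_Ioc]
  refine (setLIntegral_pos_iff (measurable_gammaPDFReal a r).ennreal_ofReal).2 ?_
  have h : Function.support (gammaPDF a r) ∩ Ioc s t = Ioc s t :=
    inter_eq_right.2 fun x hx ↦
      (ENNReal.ofReal_pos.2 (gammaPDFReal_pos ha hr (hs.trans hx.1))).ne'
  change 0 < volume (Function.support (gammaPDF a r) ∩ Ioc s t)
  rw [h]
  simpa using hst

theorem strictMonoOn_cdf_gammaMeasure {a r : ℝ} (ha : 0 < a) (hr : 0 < r) :
    StrictMonoOn (cdf (gammaMeasure a r)) (Ioi 0) := by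
  have := isProbabilityMeasure_gammaMeasure ha hr
  intro s hs t _ hst
  have h := gammaMeasure_Ioc_pos ha hr hs hst
  rw [← measure_cdf (gammaMeasure a r), StieltjesFunction.measure_Ioc, ENNReal.ofReal_pos] at h
  exact sub_pos.1 h

/-- For independent `χ²(2M)`-distributed `X` and `Y` (i.e. Gamma
with shape `M` and rate `1/2`) and `ε(α) = P(X ≥ (1+α)·Y)`, for every
`ε₀ ∈ (0, 1/2)` there is a unique `α₀ > 0` with `ε(α₀) = ε₀`. -/
theorem stmt_9
    {Ω : Type*} [MeasurableSpace Ω] (P : Measure Ω) [IsProbabilityMeasure P]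
    (M : ℕ) (hM : 1 ≤ M) (X Y : Ω → ℝ) (hX : Measurable X) (hY : Measurable Y)
    (hXlaw : Measure.map X P = gammaMeasure M (1 / 2))
    (hYlaw : Measure.map Y P = gammaMeasure M (1 / 2))
    (hindep : IndepFun X Y P)
    (ε : ℝ → ℝ) (hε : ∀ α, ε α = (P {ω | X ω ≥ (1 + α) * Y ω}).toReal)
    (ε₀ : ℝ) (hε₀pos : 0 < ε₀) (hε₀lt : ε₀ < 1 / 2) :
    ∃! α₀ : ℝ, 0 < α₀ ∧ ε α₀ = ε₀ := by
  have hM' : (0 : ℝ) < M := by exact_mod_cast hM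
  have hprob := isProbabilityMeasure_gammaMeasure hM' (one_half_pos (α := ℝ))
  have hpos := ae_pos_gammaMeasure M (1 / 2)
  have hmono := strictMonoOn_cdf_gammaMeasure hM' (one_half_pos (α := ℝ))
  have hnull := nullSingletonClass_gammaMeasure M (1 / 2)
  generalize gammaMeasure M (1 / 2) = μ at *
  set F : ℝ → ℝ := fun c ↦ ∫ y, (1 - cdf μ (c * y)) ∂μ
  have hF (c : ℝ) : F c = (μ.prod μ).real {p | c * p.2 ≤ p.1} :=
    (measureReal_prod_mul_snd_le_fst μ c).symm
  have hεF (α : ℝ) : ε α = F (1 + α) := by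
    have hS : MeasurableSet {p : ℝ × ℝ | (1 + α) * p.2 ≤ p.1} :=
      measurableSet_le (by fun_prop) (by fun_prop)
    have hjoint := (indepFun_iff_map_prod_eq_prod_map_map hX.aemeasurable hY.aemeasurable).1 hindep
    rw [hXlaw, hYlaw] at hjoint
    rw [hε, hF, ← hjoint, measureReal_def,
      Measure.map_apply (hX.prodMk hY) hS]
    rfl
  have hF1 : F 1 = 1 / 2 := by
    rw [← measureReal_prod_snd_le_fst μ, hF]
    simp only [one_mul]
  have hanti : StrictAntiOn F (Ioi 0) := strictAntiOn_integral_one_sub_cdf_mul μ hpos hmono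
  obtain ⟨b, hFb, hb⟩ := (((tendsto_integral_one_sub_cdf_mul_atTop μ hpos).eventually_lt_const
    hε₀pos).and (eventually_ge_atTop 1)).exists
  obtain ⟨c, hc, hFc⟩ := intermediate_value_Icc' hb
    (continuous_integral_one_sub_cdf_mul μ).continuousOn ⟨hFb.le, hε₀lt.le.trans hF1.ge⟩
  have hc1 : 1 < c := by
    refine lt_of_le_of_ne hc.1 ?_
    rintro rfl
    exact hε₀lt.ne (hFc.symm.trans hF1)
  refine ⟨c - 1, ⟨sub_pos.2 hc1, by rw [hεF, add_sub_cancel]; exact hFc⟩, ?_⟩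
  rintro α ⟨hα, hεα⟩
  rw [hεF] at hεα
  have := hanti.injOn (mem_Ioi.2 (by linarith : 0 < 1 + α))
    (mem_Ioi.2 (zero_lt_one.trans hc1)) (hεα.trans hFc.symm)
  linarith
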